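/- arXiv:2403.03802 — 2 statements merged into one kernel-verified Lean document; each statement's English description precedes it below -/
import Mathlib

section
/- Let X be a nonnegative random variable with CDF F such that x ↦ F(x)/x is decreasing on (0,∞) (i.e. F is DDA, equivalently F is anti-star-shaped, equivalently F^{-1} is star-shaped). Let 1 ≤ i ≤ n and 1 ≤ j ≤ m, and define for x ∈ [0,1]: Z(x) = (i/(n+1))·(1 − I_x(i+1, n−i+1)) − (j/(m+1))·(1 − I_x(j+1, m−j+1)), where I_x(a,b) denotes the CDF of the Beta(a,b) distribution evaluated at x. If Z(r) ≥ 0 for every r ∈ (0,1) satisfying r^{i−j}(1−r)^{(n−i)−(m−j)} = B(i, n−i+1)/B(j, m−j+1), where B(·,·) is the Beta function, then X_{i:n} ≥_ss X_{j:m}. -/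
open MeasureTheory Set Filter

/-- Generalized inverse (quantile function) `F⁻¹(p) = inf {x | p ≤ F x}` of a CDF `F`. -/
noncomputable def qf (F : ℝ → ℝ) (p : ℝ) : ℝ := sInf {x | p ≤ F x}

/-- `F` is a cumulative distribution function: monotone, right-continuous, with limits
`0` at `-∞` and `1` at `+∞`. -/
def IsCDF (F : ℝ → ℝ) : Prop :=
  Monotone F ∧ (∀ x, ContinuousWithinAt F (Set.Ici x) x) ∧
    Tendsto F atBot (nhds 0) ∧ Tendsto F atTop (nhds 1)

/-- The (real) Beta function `B(a,b) = ∫₀¹ t^(a-1) (1-t)^(b-1) dt`. -/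
noncomputable def Bfun (a b : ℝ) : ℝ :=
  ∫ t in Set.Ioo (0:ℝ) 1, t ^ (a - 1) * (1 - t) ^ (b - 1)

/-- The Beta(i, n-i+1) distribution on `ℝ`, i.e. the law of the `i`-th order statistic
`B_{i:n}` of an i.i.d. uniform sample of size `n`. -/
noncomputable def betaLaw (i n : ℕ) : Measure ℝ :=
  (volume.restrict (Set.Ioo (0:ℝ) 1)).withDensity fun t =>
    ENNReal.ofReal (t ^ ((i:ℝ) - 1) * (1 - t) ^ ((n:ℝ) - (i:ℝ)) / Bfun (i:ℝ) ((n:ℝ) - (i:ℝ) + 1))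

/-- The law of the `i`-th order statistic `X_{i:n}` of an i.i.d. sample of size `n` from the
CDF `F`: the pushforward of the Beta(i, n-i+1) measure under the quantile function `F⁻¹`. -/
noncomputable def osLaw (F : ℝ → ℝ) (i n : ℕ) : Measure ℝ := (betaLaw i n).map (qf F)

/-- The `k`-th harmonic number `H_k = ∑_{r=1}^k 1/r`. -/
noncomputable def harm (k : ℕ) : ℝ := ∑ r ∈ Finset.Icc 1 k, (1:ℝ) / r

/-- Increasing concave order: `icvLE μ ν` means a random variable with law `μ` dominates one
with law `ν` in the increasing concave order, i.e. `E u(X) ≥ E u(Y)` for every increasing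
concave `u` for which both expectations exist. -/
def icvLE (μ ν : MeasureTheory.Measure ℝ) : Prop :=
  ∀ u : ℝ → ℝ, Monotone u → ConcaveOn ℝ Set.univ u →
    MeasureTheory.Integrable u μ → MeasureTheory.Integrable u ν →
      ∫ x, u x ∂ν ≤ ∫ x, u x ∂μ

/-- Increasing convex order: `icxLE μ ν` means a random variable with law `μ` dominates one
with law `ν` in the increasing convex order, i.e. `E u(X) ≥ E u(Y)` for every increasing
convex `u` for which both expectations exist. -/
def icxLE (μ ν : MeasureTheory.Measure ℝ) : Prop :=
  ∀ u : ℝ → ℝ, Monotone u → ConvexOn ℝ Set.univ u →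
    MeasureTheory.Integrable u μ → MeasureTheory.Integrable u ν →
      ∫ x, u x ∂ν ≤ ∫ x, u x ∂μ

/-- A star-shaped function on `[0,∞)`: nonnegative there, vanishing at `0`, with
`x ↦ φ x / x` increasing on `(0,∞)`. -/
def StarShaped (φ : ℝ → ℝ) : Prop :=
  φ 0 = 0 ∧ (∀ x, 0 ≤ x → 0 ≤ φ x) ∧ MonotoneOn (fun x => φ x / x) (Set.Ioi 0)

/-- Star-shaped order: `ssLE μ ν` means a (nonnegative) random variable with law `μ`
dominates one with law `ν` in the star-shaped order, i.e. `E φ(X) ≥ E φ(Y)` for every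
star-shaped `φ` for which both expectations exist. -/
def ssLE (μ ν : MeasureTheory.Measure ℝ) : Prop :=
  ∀ φ : ℝ → ℝ, StarShaped φ → MeasureTheory.Integrable φ μ → MeasureTheory.Integrable φ ν →
    ∫ x, φ x ∂ν ≤ ∫ x, φ x ∂μ

/-- The CDF `I_x(a,b)` of the Beta(a,b) distribution (regularized incomplete Beta). -/
noncomputable def betaCDF (a b : ℝ) (x : ℝ) : ℝ :=
  (∫ t in Set.Ioo (0:ℝ) (min x 1), t ^ (a - 1) * (1 - t) ^ (b - 1)) / Bfun a b

open intervalIntegral in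
/-- Key calculus lemma. -/
lemma tail_nonneg (d : ℝ → ℝ) (hd : Continuous d) (h0 : ∫ t in (0:ℝ)..1, d t = 0)
    (hr : ∀ r ∈ Set.Ioo (0:ℝ) 1, d r = 0 → 0 ≤ ∫ t in r..1, t * d t) :
    ∀ x ∈ Set.Icc (0:ℝ) 1, 0 ≤ ∫ t in x..1, t * d t := by
  have hw : Continuous (fun t => t * d t) := by fun_prop
  set H : ℝ → ℝ := fun x => ∫ t in (0:ℝ)..x, t * d t with hH
  set D : ℝ → ℝ := fun x => ∫ t in (0:ℝ)..x, d t with hD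
  have dH : ∀ x, HasDerivAt H (x * d x) x := fun x =>
    integral_hasDerivAt_right (hw.intervalIntegrable _ _)
      (hw.stronglyMeasurableAtFilter _ _) hw.continuousAt
  have dD : ∀ x, HasDerivAt D (d x) x := fun x =>
    integral_hasDerivAt_right (hd.intervalIntegrable _ _)
      (hd.stronglyMeasurableAtFilter _ _) hd.continuousAt
  have cH : Continuous H := continuous_iff_continuousAt.2 fun x => (dH x).continuousAt
  have cD : Continuous D := continuous_iff_continuousAt.2 fun x => (dD x).continuousAt
  have hZ : ∀ x, ∫ t in x..1, t * d t = H 1 - H x := fun x => by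
    rw [hH]
    exact (integral_interval_sub_left (hw.intervalIntegrable _ _) (hw.intervalIntegrable _ _)).symm
  simp only [hZ] at hr ⊢
  -- identity
  have hid : ∀ x, x * D x = H x + ∫ t in (0:ℝ)..x, D t := by
    intro x
    have h1 : ∫ t in (0:ℝ)..x, (D t + t * d t) = x * D x - 0 * D 0 := by
      apply integral_eq_sub_of_hasDerivAt (f := fun t => t * D t)
      · intro t _
        have := (hasDerivAt_id' t).fun_mul (dD t)
        rw [one_mul] at this
        exact this
      · exact (cD.add hw).intervalIntegrable _ _
    rw [integral_add (cD.intervalIntegrable _ _) (hw.intervalIntegrable _ _)] at h1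
    simp only [hH]
    linarith
  by_contra hcon
  push Not at hcon
  obtain ⟨y, hy, hyneg⟩ := hcon
  obtain ⟨x0, hx0, hmax⟩ := isCompact_Icc.exists_isMaxOn (nonempty_Icc.2 (zero_le_one' ℝ))
    cH.continuousOn
  have hm : ∀ x ∈ Set.Icc (0:ℝ) 1, H x ≤ H x0 := fun x hx => hmax hx
  -- no interior point has H x = max
  have hint : ∀ x ∈ Set.Ioo (0:ℝ) 1, H x < H x0 := by
    intro x hx
    refine lt_of_le_of_ne (hm x (Ioo_subset_Icc_self hx)) fun he => ?_
    have hloc : IsLocalMax H x := by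
      filter_upwards [Icc_mem_nhds hx.1 hx.2] with z hz
      rw [he]; exact hm z hz
    have := hloc.hasDerivAt_eq_zero (dH x)
    have hdx : d x = 0 := by
      rcases mul_eq_zero.1 this with h | h
      · exact absurd h hx.1.ne'
      · exact h
    have := hr x hx hdx
    have := hm y hy
    linarith
  have hH1 : H 1 < H x0 := by have := hm y hy; linarith
  have hx00 : x0 = 0 := by
    by_contra hne
    rcases lt_or_eq_of_le hx0.2 with h | h
    · exact lt_irrefl _ (hint x0 ⟨lt_of_le_of_ne hx0.1 (Ne.symm hne), h⟩)
    · rw [h] at hH1; exact lt_irrefl _ hH1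
  have hneg : ∀ x ∈ Set.Ioc (0:ℝ) 1, H x < 0 := by
    have h00 : H x0 = 0 := by rw [hx00]; simp [hH]
    intro x hx
    rw [← h00]
    rcases lt_or_eq_of_le hx.2 with h | h
    · exact hint x ⟨hx.1, h⟩
    · rw [h]; exact hH1
  obtain ⟨z, hz, hzmax⟩ := isCompact_Icc.exists_isMaxOn (nonempty_Icc.2 (zero_le_one' ℝ))
    cD.continuousOn
  have hD0 : D 0 = 0 := by simp [hD]
  have hD1 : D 1 = 0 := h0
  obtain ⟨z', hz', hzm⟩ : ∃ z' ∈ Set.Ioc (0:ℝ) 1, ∀ x ∈ Set.Icc (0:ℝ) 1, D x ≤ D z' := by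
    rcases eq_or_lt_of_le hz.1 with h | h
    · refine ⟨1, by simp, fun x hx => ?_⟩
      have : D x ≤ D z := hzmax hx
      rw [← h] at this
      linarith
    · exact ⟨z, ⟨h, hz.2⟩, fun x hx => hzmax hx⟩
  have h1 := hid z'
  have h2 : ∫ t in (0:ℝ)..z', D t ≤ ∫ t in (0:ℝ)..z', D z' := by
    apply integral_mono_on hz'.1.le (cD.intervalIntegrable _ _) (by simp)
    intro x hx
    exact hzm x ⟨hx.1, hx.2.trans hz'.2⟩
  have h3 := hneg z' hz'
  simp at h2
  linarith

lemma cont_P (a b : ℝ) (ha : 0 ≤ a) (hb : 0 ≤ b) :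
    Continuous (fun t : ℝ => t ^ a * (1 - t) ^ b) := by
  apply Continuous.mul
  · exact continuous_id.rpow_const (fun x => Or.inr ha)
  · exact (continuous_const.sub continuous_id).rpow_const (fun x => Or.inr hb)

lemma setInt_eq (f : ℝ → ℝ) (x y : ℝ) (h : x ≤ y) :
    ∫ t in Set.Ioo x y, f t = ∫ t in x..y, f t := by
  rw [intervalIntegral.integral_of_le h, integral_Ioc_eq_integral_Ioo]

lemma Bfun_eq (a b : ℝ) : Bfun a b = ∫ t in (0:ℝ)..1, t ^ (a-1) * (1 - t) ^ (b-1) := by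
  rw [Bfun, setInt_eq _ _ _ zero_le_one]

lemma Bfun_pos (a b : ℝ) (ha : 1 ≤ a) (hb : 1 ≤ b) : 0 < Bfun a b := by
  rw [Bfun_eq]
  apply intervalIntegral.intervalIntegral_pos_of_pos_on
  · exact (cont_P _ _ (by linarith) (by linarith)).intervalIntegrable _ _
  · intro x hx
    have : 0 < 1 - x := by linarith [hx.2]
    have := hx.1
    positivity
  · exact one_pos

lemma Bfun_rec (a b : ℝ) (ha : 1 ≤ a) (hb : 0 ≤ b) :
    (a + b + 1) * Bfun (a + 1) (b + 1) = a * Bfun a (b + 1) := by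
  have c1 : Continuous (fun t : ℝ => t ^ (a - 1) * (1 - t) ^ b) :=
    cont_P _ _ (by linarith) (by linarith)
  have c2 : Continuous (fun t : ℝ => t ^ a * (1 - t) ^ b) :=
    cont_P _ _ (by linarith) (by linarith)
  have h : ∫ t in (0:ℝ)..1, (a * (t ^ (a - 1) * (1 - t) ^ b) -
      (a + b + 1) * (t ^ a * (1 - t) ^ b)) = 
      (1:ℝ) ^ a * (1 - 1) ^ (b + 1) - (0:ℝ) ^ a * (1 - 0) ^ (b + 1) := by
    apply intervalIntegral.integral_eq_sub_of_hasDerivAt_of_le zero_le_one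
      (f := fun t : ℝ => t ^ a * (1 - t) ^ (b + 1))
    · exact (cont_P _ _ (by linarith) (by linarith)).continuousOn
    · intro t ht
      have h1 : 0 < 1 - t := by linarith [ht.2]
      have d1 : HasDerivAt (fun t : ℝ => t ^ a) (a * t ^ (a - 1)) t :=
        Real.hasDerivAt_rpow_const (Or.inr ha)
      have d2 : HasDerivAt (fun t : ℝ => (1 - t) ^ (b + 1)) (-1 * (b + 1) * (1 - t) ^ (b + 1 - 1)) t :=
        ((hasDerivAt_id t).const_sub 1).rpow_const (Or.inr (by linarith))
      refine (d1.fun_mul d2).congr_deriv ?_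
      have e1 : t ^ a = t ^ (a - 1) * t := by
        rw [← Real.rpow_add_one ht.1.ne']; simp
      rw [add_sub_cancel_right, Real.rpow_add_one h1.ne', e1]
      ring
    · exact (Continuous.sub (continuous_const.mul c1) (continuous_const.mul c2)).intervalIntegrable _ _
  have c1' : Continuous (fun t : ℝ => a * (t ^ (a - 1) * (1 - t) ^ b)) := continuous_const.mul c1
  have c2' : Continuous (fun t : ℝ => (a + b + 1) * (t ^ a * (1 - t) ^ b)) :=
    continuous_const.mul c2
  rw [intervalIntegral.integral_sub (c1'.intervalIntegrable _ _) (c2'.intervalIntegrable _ _), intervalIntegral.integral_const_mul,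
    intervalIntegral.integral_const_mul, sub_self,
    Real.zero_rpow (by linarith), Real.zero_rpow (by linarith)] at h
  rw [Bfun_eq, Bfun_eq]
  simp only [add_sub_cancel_right]
  linarith

lemma tail_eq (a b x : ℝ) (ha : 1 ≤ a) (hb : 0 ≤ b) (hx : x ∈ Set.Icc (0:ℝ) 1) :
    a / (a + b + 1) * (1 - betaCDF (a + 1) (b + 1) x) =
      ∫ t in x..1, t * (t ^ (a - 1) * (1 - t) ^ b / Bfun a (b + 1)) := by
  have c2 : Continuous (fun t : ℝ => t ^ a * (1 - t) ^ b) :=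
    cont_P _ _ (by linarith) (by linarith)
  have hB := Bfun_pos a (b+1) ha (by linarith)
  have hB' := Bfun_pos (a+1) (b+1) (by linarith) (by linarith)
  have hrec := Bfun_rec a b ha hb
  have e : ∫ t in x..1, t * (t ^ (a - 1) * (1 - t) ^ b / Bfun a (b + 1)) =
      (∫ t in x..1, t ^ a * (1 - t) ^ b) / Bfun a (b + 1) := by
    rw [← intervalIntegral.integral_div]
    apply intervalIntegral.integral_congr
    intro t ht
    rw [uIcc_of_le hx.2] at ht
    have ht0 : 0 ≤ t := hx.1.trans ht.1
    have e1 : t ^ a = t * t ^ (a - 1) := by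
      rcases eq_or_lt_of_le ht0 with h | h
      · rw [← h, Real.zero_rpow (by linarith)]; simp
      · rw [mul_comm, ← Real.rpow_add_one h.ne']; simp
    simp only [e1]
    ring
  rw [e, betaCDF, min_eq_left hx.2, setInt_eq _ _ _ hx.1]
  have hs : Bfun (a+1) (b+1) = (∫ t in (0:ℝ)..x, t ^ a * (1 - t) ^ b) +
      ∫ t in x..1, t ^ a * (1 - t) ^ b := by
    rw [intervalIntegral.integral_add_adjacent_intervals (c2.intervalIntegrable _ _)
      (c2.intervalIntegrable _ _), Bfun_eq]
    simp only [add_sub_cancel_right]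
  simp only [add_sub_cancel_right]
  have : ∫ t in x..1, t ^ a * (1 - t) ^ b =
    Bfun (a+1) (b+1) - ∫ t in (0:ℝ)..x, t ^ a * (1 - t) ^ b := by linarith
  rw [this]
  have hab : a + b + 1 ≠ 0 := by linarith
  generalize (∫ t in (0:ℝ)..x, t ^ a * (1 - t) ^ b) = I at *
  field_simp
  linear_combination (-(Bfun (a+1) (b+1) - I)) * hrec

section quantile
variable (F : ℝ → ℝ)

lemma qset_nonempty (hF : IsCDF F) {p : ℝ} (hp : p ∈ Set.Ioo (0:ℝ) 1) :
    {x | p ≤ F x}.Nonempty := by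
  obtain ⟨x, hx⟩ := (hF.2.2.2.eventually (lt_mem_nhds hp.2)).exists
  exact ⟨x, hx.le⟩

lemma qset_lb (hFneg : ∀ x : ℝ, x < 0 → F x = 0) {p : ℝ} (hp : p ∈ Set.Ioo (0:ℝ) 1) :
    ∀ x ∈ {x | p ≤ F x}, 0 ≤ x := by
  intro x hx
  by_contra h
  have := hFneg x (not_le.1 h)
  have h2 : p ≤ F x := hx
  linarith [hp.1]

lemma qf_nonneg (hF : IsCDF F) (hFneg : ∀ x : ℝ, x < 0 → F x = 0) {p : ℝ}
    (hp : p ∈ Set.Ioo (0:ℝ) 1) : 0 ≤ qf F p :=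
  le_csInf (qset_nonempty F hF hp) (qset_lb F hFneg hp)

lemma qf_le (hFneg : ∀ x : ℝ, x < 0 → F x = 0) {p x : ℝ}
    (hp : p ∈ Set.Ioo (0:ℝ) 1) (h : p ≤ F x) : qf F p ≤ x :=
  csInf_le ⟨0, qset_lb F hFneg hp⟩ h

lemma le_F_qf (hF : IsCDF F) (hFneg : ∀ x : ℝ, x < 0 → F x = 0) {p : ℝ}
    (hp : p ∈ Set.Ioo (0:ℝ) 1) : p ≤ F (qf F p) := by
  have hc : Tendsto F (nhdsWithin (qf F p) (Set.Ioi (qf F p))) (nhds (F (qf F p))) :=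
    (hF.2.1 (qf F p)).mono_left (nhdsWithin_mono _ Ioi_subset_Ici_self)
  apply ge_of_tendsto hc
  filter_upwards [self_mem_nhdsWithin] with y hy
  obtain ⟨z, hz, hzy⟩ := exists_lt_of_csInf_lt (qset_nonempty F hF hp) hy
  exact le_trans hz (hF.1 hzy.le)

lemma qf_mono (hF : IsCDF F) (hFneg : ∀ x : ℝ, x < 0 → F x = 0) :
    MonotoneOn (qf F) (Set.Ioo 0 1) := by
  intro s hs t ht hst
  exact qf_le F hFneg hs (hst.trans (le_F_qf F hF hFneg ht))

lemma qf_star (hF : IsCDF F) (hFneg : ∀ x : ℝ, x < 0 → F x = 0)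
    (hDDA : AntitoneOn (fun x => F x / x) (Set.Ioi (0:ℝ))) :
    MonotoneOn (fun t => qf F t / t) (Set.Ioo 0 1) := by
  intro s hs t ht hst
  have hs0 := hs.1
  have ht0 := ht.1
  change qf F s / s ≤ qf F t / t
  rcases eq_or_lt_of_le (qf_nonneg F hF hFneg ht) with h | h
  · have := qf_mono F hF hFneg hs ht hst
    have h0 := qf_nonneg F hF hFneg hs
    have : qf F s = 0 := by linarith
    rw [this, ← h]; simp
  · set x := qf F t
    have hy : 0 < x * s / t := by positivity
    have hyx : x * s / t ≤ x := by
      rw [div_le_iff₀ ht0]; gcongr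
    have h1 : F x / x ≤ F (x * s / t) / (x * s / t) := hDDA hy h hyx
    have h2 : t ≤ F x := le_F_qf F hF hFneg ht
    have h3 : t / x ≤ F (x * s / t) / (x * s / t) :=
      le_trans (by gcongr) h1
    rw [le_div_iff₀ hy] at h3
    have h4 : t / x * (x * s / t) = s := by field_simp
    rw [h4] at h3
    have := qf_le F hFneg hs h3
    rw [div_le_div_iff₀ hs0 ht0]
    rwa [le_div_iff₀ ht0] at this

lemma phi_star (hF : IsCDF F) (hFneg : ∀ x : ℝ, x < 0 → F x = 0)
    (hDDA : AntitoneOn (fun x => F x / x) (Set.Ioi (0:ℝ))) (φ : ℝ → ℝ) (hφ : StarShaped φ) :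
    MonotoneOn (fun t => φ (qf F t) / t) (Set.Ioo 0 1) := by
  intro s hs t ht hst
  obtain ⟨h0, hn, hm⟩ := hφ
  have hs0 := hs.1
  have ht0 := ht.1
  have hqt := qf_nonneg F hF hFneg ht
  have hle := qf_mono F hF hFneg hs ht hst
  change φ (qf F s) / s ≤ φ (qf F t) / t
  rcases eq_or_lt_of_le (qf_nonneg F hF hFneg hs) with h | h
  · rw [← h, h0, zero_div]
    exact div_nonneg (hn _ hqt) ht0.le
  · have ht' : 0 < qf F t := lt_of_lt_of_le h hle
    have h1 : qf F s / s ≤ qf F t / t := qf_star F hF hFneg hDDA hs ht hst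
    have h2 : φ (qf F s) / qf F s ≤ φ (qf F t) / qf F t := hm h ht' hle
    have e1 : φ (qf F s) / s = φ (qf F s) / qf F s * (qf F s / s) := by field_simp
    have e2 : φ (qf F t) / t = φ (qf F t) / qf F t * (qf F t / t) := by field_simp
    rw [e1, e2]
    apply mul_le_mul h2 h1 (by positivity)
    exact div_nonneg (hn _ hqt) hqt
end quantile

/-- upper sets of `(0,1)` agree a.e. with intervals `(x,1)`. -/
lemma upper_ae (h : ℝ → ℝ) (hm : MonotoneOn h (Set.Ioo 0 1)) (s : ℝ) :
    ∃ x ∈ Set.Icc (0:ℝ) 1, ({t | s < h t} ∩ Set.Ioo 0 1 : Set ℝ) =ᵐ[volume] Set.Ioo x 1 := by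
  set S := ({t | s < h t} ∩ Set.Ioo 0 1 : Set ℝ) with hS
  rcases S.eq_empty_or_nonempty with he | hne
  · exact ⟨1, by simp, by rw [he]; simp⟩
  have hb : ∀ t ∈ S, (0:ℝ) ≤ t := fun t ht => ht.2.1.le
  have hbb : BddBelow S := ⟨0, hb⟩
  have hx0 : 0 ≤ sInf S := le_csInf hne hb
  refine ⟨sInf S, ⟨hx0, ?_⟩, ?_⟩
  · obtain ⟨t, ht⟩ := hne
    exact (csInf_le hbb ht).trans ht.2.2.le
  · have h1 : Set.Ioo (sInf S) 1 ⊆ S := by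
      intro y hy
      obtain ⟨z, hz, hzy⟩ := exists_lt_of_csInf_lt hne hy.1
      have hy01 : y ∈ Set.Ioo (0:ℝ) 1 := ⟨lt_of_le_of_lt hx0 hy.1, hy.2⟩
      exact ⟨lt_of_lt_of_le hz.1 (hm hz.2 hy01 hzy.le), hy01⟩
    have h2 : S ⊆ Set.Ico (sInf S) 1 := fun y hy => ⟨csInf_le hbb hy, hy.2.2⟩
    exact (h2.eventuallyLE.trans Ioo_ae_eq_Ico.symm.le).antisymm h1.eventuallyLE

lemma lint_le (h p q : ℝ → ℝ) (hm : MonotoneOn h (Set.Ioo 0 1))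
    (hh : ∀ t ∈ Set.Ioo (0:ℝ) 1, 0 ≤ h t)
    (hp : Continuous p) (hq : Continuous q)
    (hp0 : ∀ t ∈ Set.Ioo (0:ℝ) 1, 0 ≤ p t) (hq0 : ∀ t ∈ Set.Ioo (0:ℝ) 1, 0 ≤ q t)
    (hpq : ∀ x ∈ Set.Icc (0:ℝ) 1, ∫ t in x..1, q t ≤ ∫ t in x..1, p t) :
    ∫⁻ t in Set.Ioo (0:ℝ) 1, ENNReal.ofReal (q t) * ENNReal.ofReal (h t) ≤
    ∫⁻ t in Set.Ioo (0:ℝ) 1, ENNReal.ofReal (p t) * ENNReal.ofReal (h t) := by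
  have hmeas : AEMeasurable h (volume.restrict (Set.Ioo (0:ℝ) 1)) :=
    aemeasurable_restrict_of_monotoneOn measurableSet_Ioo hm
  have key : ∀ f : ℝ → ℝ, Continuous f → (∀ t ∈ Set.Ioo (0:ℝ) 1, 0 ≤ f t) →
      (∫⁻ t in Set.Ioo (0:ℝ) 1, ENNReal.ofReal (f t) * ENNReal.ofReal (h t) =
      ∫⁻ s in Set.Ioi (0:ℝ), ((volume.restrict (Set.Ioo (0:ℝ) 1)).withDensity
        (fun t => ENNReal.ofReal (f t))) {t | s < h t}) ∧
      ∀ s, ∀ x ∈ Set.Icc (0:ℝ) 1, ({t | s < h t} ∩ Set.Ioo 0 1 : Set ℝ) =ᵐ[volume] Set.Ioo x 1 →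
        ((volume.restrict (Set.Ioo (0:ℝ) 1)).withDensity
        (fun t => ENNReal.ofReal (f t))) {t | s < h t} = ENNReal.ofReal (∫ t in x..1, f t) := by
    intro f hf hf0
    have hac : ((volume.restrict (Set.Ioo (0:ℝ) 1)).withDensity
        (fun t => ENNReal.ofReal (f t))) ≪ volume.restrict (Set.Ioo (0:ℝ) 1) :=
      withDensity_absolutelyContinuous _ _
    constructor
    · rw [← lintegral_eq_lintegral_meas_lt]
      · rw [lintegral_withDensity_eq_lintegral_mul₀ (by fun_prop) (by fun_prop)]
        rfl
      · apply hac.ae_le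
        exact (ae_restrict_iff' measurableSet_Ioo).2 (ae_of_all _ hh)
      · exact hmeas.mono_ac hac
    · intro s x hx hae
      rw [withDensity_apply' _ _, Measure.restrict_restrict' measurableSet_Ioo,
        setLIntegral_congr hae, ← setInt_eq _ _ _ hx.2,
        ofReal_integral_eq_lintegral_ofReal]
      · exact (hf.integrableOn_Icc (a := x) (b := 1)).mono_set Ioo_subset_Icc_self
      · refine (ae_restrict_iff' measurableSet_Ioo).2 (ae_of_all _ fun t ht => ?_)
        exact hf0 t ⟨lt_of_le_of_lt hx.1 ht.1, ht.2⟩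
  rw [(key q hq hq0).1, (key p hp hp0).1]
  apply lintegral_mono
  intro s
  obtain ⟨x, hx, hae⟩ := upper_ae h hm s
  dsimp only
  rw [(key q hq hq0).2 s x hx hae, (key p hp hp0).2 s x hx hae]
  exact ENNReal.ofReal_le_ofReal (hpq x hx)

/-- If a nonnegative random variable has a DDA CDF `F` (i.e. `F(x)/x`
decreasing on `(0,∞)`) and `Z(r) ≥ 0` for every root `r ∈ (0,1)` of
`r^(i-j)(1-r)^((n-i)-(m-j)) = B(i,n-i+1)/B(j,m-j+1)`, where
`Z(x) = i/(n+1)·(1 - I_x(i+1,n-i+1)) - j/(m+1)·(1 - I_x(j+1,m-j+1))`, then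
`X_{i:n} ≥_ss X_{j:m}`. -/
theorem stmt15 (F : ℝ → ℝ) (hF : IsCDF F) (hFneg : ∀ x : ℝ, x < 0 → F x = 0)
    (hDDA : AntitoneOn (fun x => F x / x) (Set.Ioi (0:ℝ)))
    (i n j m : ℕ) (hi1 : 1 ≤ i) (hin : i ≤ n) (hj1 : 1 ≤ j) (hjm : j ≤ m)
    (Z : ℝ → ℝ)
    (hZ : ∀ x : ℝ, Z x =
      (i:ℝ) / ((n:ℝ) + 1) * (1 - betaCDF ((i:ℝ) + 1) ((n:ℝ) - (i:ℝ) + 1) x) -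
      (j:ℝ) / ((m:ℝ) + 1) * (1 - betaCDF ((j:ℝ) + 1) ((m:ℝ) - (j:ℝ) + 1) x))
    (hroot : ∀ r ∈ Set.Ioo (0:ℝ) 1,
      r ^ ((i:ℝ) - (j:ℝ)) * (1 - r) ^ (((n:ℝ) - (i:ℝ)) - ((m:ℝ) - (j:ℝ))) =
        Bfun (i:ℝ) ((n:ℝ) - (i:ℝ) + 1) / Bfun (j:ℝ) ((m:ℝ) - (j:ℝ) + 1) →
      0 ≤ Z r) :
    ssLE (osLaw F i n) (osLaw F j m) := by
  intro φ hφ hμ hν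
  have hi : (1:ℝ) ≤ i := by exact_mod_cast hi1
  have hj : (1:ℝ) ≤ j := by exact_mod_cast hj1
  have hni : (0:ℝ) ≤ (n:ℝ) - i := sub_nonneg.2 (by exact_mod_cast hin)
  have hmj : (0:ℝ) ≤ (m:ℝ) - j := sub_nonneg.2 (by exact_mod_cast hjm)
  have hBi := Bfun_pos (i:ℝ) ((n:ℝ) - i + 1) hi (by linarith)
  have hBj := Bfun_pos (j:ℝ) ((m:ℝ) - j + 1) hj (by linarith)
  set p : ℝ → ℝ := fun t =>
    t ^ ((i:ℝ) - 1) * (1 - t) ^ ((n:ℝ) - (i:ℝ)) / Bfun (i:ℝ) ((n:ℝ) - (i:ℝ) + 1) with hp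
  set q : ℝ → ℝ := fun t =>
    t ^ ((j:ℝ) - 1) * (1 - t) ^ ((m:ℝ) - (j:ℝ)) / Bfun (j:ℝ) ((m:ℝ) - (j:ℝ) + 1) with hq
  have cp : Continuous p := (cont_P _ _ (by linarith) hni).div_const _
  have cq : Continuous q := (cont_P _ _ (by linarith) hmj).div_const _
  have p0 : ∀ t ∈ Set.Ioo (0:ℝ) 1, 0 ≤ p t := by
    intro t ht
    have : 0 < 1 - t := by linarith [ht.2]
    have := ht.1
    simp only [hp]; positivity
  have q0 : ∀ t ∈ Set.Ioo (0:ℝ) 1, 0 ≤ q t := by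
    intro t ht
    have : 0 < 1 - t := by linarith [ht.2]
    have := ht.1
    simp only [hq]; positivity
  have ip : ∫ t in (0:ℝ)..1, p t = 1 := by
    simp only [hp]
    rw [intervalIntegral.integral_div, Bfun_eq]
    rw [Bfun_eq] at hBi
    simp only [add_sub_cancel_right] at hBi ⊢
    exact div_self hBi.ne'
  have iq : ∫ t in (0:ℝ)..1, q t = 1 := by
    simp only [hq]
    rw [intervalIntegral.integral_div, Bfun_eq]
    rw [Bfun_eq] at hBj
    simp only [add_sub_cancel_right] at hBj ⊢
    exact div_self hBj.ne'
  have ctp : Continuous (fun t => t * p t) := by fun_prop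
  have ctq : Continuous (fun t => t * q t) := by fun_prop
  have hdiff : ∀ x, ∫ t in x..1, t * (p t - q t) =
      (∫ t in x..1, t * p t) - ∫ t in x..1, t * q t := by
    intro x
    rw [← intervalIntegral.integral_sub (ctp.intervalIntegrable _ _) (ctq.intervalIntegrable _ _)]
    simp only [mul_sub]
  have hZ' : ∀ x ∈ Set.Icc (0:ℝ) 1, Z x = ∫ t in x..1, t * (p t - q t) := by
    intro x hx
    rw [hdiff, hZ, ← tail_eq _ _ x hi hni hx, ← tail_eq _ _ x hj hmj hx]
    rw [add_sub_cancel, add_sub_cancel]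
  have htail := tail_nonneg (fun t => p t - q t) (cp.sub cq)
    (by
      rw [intervalIntegral.integral_sub (cp.intervalIntegrable _ _) (cq.intervalIntegrable _ _),
        ip, iq, sub_self])
    (by
      intro r hr hd
      rw [← hZ' r (Ioo_subset_Icc_self hr)]
      apply hroot r hr
      have h1 : 0 < 1 - r := by linarith [hr.2]
      have hd' : p r = q r := sub_eq_zero.1 hd
      have e1 : (i:ℝ) - j = ((i:ℝ) - 1) - ((j:ℝ) - 1) := by ring
      simp only [hp, hq] at hd'
      rw [e1, Real.rpow_sub hr.1, Real.rpow_sub h1]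
      have a1 : 0 < r ^ ((j:ℝ) - 1) := Real.rpow_pos_of_pos hr.1 _
      have a2 : 0 < (1 - r) ^ ((m:ℝ) - j) := Real.rpow_pos_of_pos h1 _
      rw [div_eq_div_iff hBi.ne' hBj.ne'] at hd'
      rw [div_mul_div_comm, div_eq_div_iff (mul_pos a1 a2).ne' hBj.ne', hd', mul_comm])
  set h : ℝ → ℝ := fun t => φ (qf F t) / t with hh
  have hmono : MonotoneOn h (Set.Ioo 0 1) := phi_star F hF hFneg hDDA φ hφ
  have g0 : ∀ t ∈ Set.Ioo (0:ℝ) 1, 0 ≤ φ (qf F t) := fun t ht =>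
    hφ.2.1 _ (qf_nonneg F hF hFneg ht)
  have hmain := lint_le h (fun t => t * p t) (fun t => t * q t) hmono
    (fun t ht => div_nonneg (g0 t ht) ht.1.le) ctp ctq
    (fun t ht => mul_nonneg ht.1.le (p0 t ht)) (fun t ht => mul_nonneg ht.1.le (q0 t ht))
    (fun x hx => by have := htail x hx; rw [hdiff] at this; linarith)
  have hqm : AEMeasurable (qf F) (volume.restrict (Set.Ioo (0:ℝ) 1)) :=
    aemeasurable_restrict_of_monotoneOn measurableSet_Ioo (qf_mono F hF hFneg)
  have hhm : AEMeasurable h (volume.restrict (Set.Ioo (0:ℝ) 1)) :=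
    aemeasurable_restrict_of_monotoneOn measurableSet_Ioo hmono
  have hgm : AEMeasurable (fun t => φ (qf F t)) (volume.restrict (Set.Ioo (0:ℝ) 1)) := by
    refine (hhm.mul aemeasurable_id).congr ?_
    refine (ae_restrict_iff' measurableSet_Ioo).2 (ae_of_all _ fun t ht => ?_)
    simp only [hh, Pi.mul_apply, id]
    have := ht.1.ne'
    field_simp
  have conv : ∀ (f : ℝ → ℝ), Continuous f → (∀ t ∈ Set.Ioo (0:ℝ) 1, 0 ≤ f t) →
      Integrable φ (((volume.restrict (Set.Ioo (0:ℝ) 1)).withDensity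
        fun t => ENNReal.ofReal (f t)).map (qf F)) →
      (∫ x, φ x ∂(((volume.restrict (Set.Ioo (0:ℝ) 1)).withDensity
        fun t => ENNReal.ofReal (f t)).map (qf F)) = 
      (∫⁻ t in Set.Ioo (0:ℝ) 1, ENNReal.ofReal (t * f t) * ENNReal.ofReal (h t)).toReal) ∧
      ∫⁻ t in Set.Ioo (0:ℝ) 1, ENNReal.ofReal (t * f t) * ENNReal.ofReal (h t) ≠ ⊤ := by
    intro f hf hf0 hint
    have hac : ((volume.restrict (Set.Ioo (0:ℝ) 1)).withDensity
        (fun t => ENNReal.ofReal (f t))) ≪ volume.restrict (Set.Ioo (0:ℝ) 1) :=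
      withDensity_absolutelyContinuous _ _
    have hqm' := hqm.mono_ac hac
    have hint' := (integrable_map_measure hint.aestronglyMeasurable hqm').1 hint
    have hnn : 0 ≤ᵐ[((volume.restrict (Set.Ioo (0:ℝ) 1)).withDensity
        (fun t => ENNReal.ofReal (f t)))] (φ ∘ qf F) := by
      apply hac.ae_le
      exact (ae_restrict_iff' measurableSet_Ioo).2 (ae_of_all _ g0)
    have hl : ∫⁻ t, ENNReal.ofReal ((φ ∘ qf F) t) ∂((volume.restrict (Set.Ioo (0:ℝ) 1)).withDensity
        (fun t => ENNReal.ofReal (f t))) =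
        ∫⁻ t in Set.Ioo (0:ℝ) 1, ENNReal.ofReal (t * f t) * ENNReal.ofReal (h t) := by
      simp only [Function.comp]
      rw [lintegral_withDensity_eq_lintegral_mul₀
        (f := fun t => ENNReal.ofReal (f t)) (by fun_prop) hgm.ennreal_ofReal]
      apply setLIntegral_congr_fun measurableSet_Ioo
      intro t ht
      have ht0 := ht.1
      simp only [Pi.mul_apply, Function.comp]
      rw [← ENNReal.ofReal_mul (hf0 t ht), ← ENNReal.ofReal_mul (mul_nonneg ht0.le (hf0 t ht))]
      congr 1
      simp only [hh]
      field_simp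
    rw [← hl]
    refine ⟨?_, ?_⟩
    · rw [integral_map hqm' hint.aestronglyMeasurable]
      exact integral_eq_lintegral_of_nonneg_ae hnn hint'.aestronglyMeasurable
    · exact ((hasFiniteIntegral_iff_ofReal hnn).1 hint'.2).ne
  obtain ⟨e1, f1⟩ := conv p cp p0 hμ
  obtain ⟨e2, f2⟩ := conv q cq q0 hν
  have e1' : ∫ x, φ x ∂(osLaw F i n) = _ := e1
  have e2' : ∫ x, φ x ∂(osLaw F j m) = _ := e2
  rw [e1', e2']
  exact ENNReal.toReal_mono f1 hmain
end

section
/- Let G be a continuous, strictly increasing CDF, let X be a random variable with continuous, strictly increasing CDF F, and let 1 ≤ i ≤ n. Assume E X_{i:n} and E[G^{-1}(B_{i:n})] are finite, and define p_{i:n}^G = G(E[G^{-1}(B_{i:n})]). Then: (1) if G^{-1} ∘ F is convex, then P(X ≤ E X_{i:n}) ≤ p_{i:n}^G; (2) if G^{-1} ∘ F is concave, then P(X ≤ E X_{i:n}) ≥ p_{i:n}^G. -/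
open MeasureTheory Set Filter

lemma cdf_mem17 (F : ℝ → ℝ) (hF : IsCDF F) (hFmono : StrictMono F) (x : ℝ) :
    F x ∈ Set.Ioo (0:ℝ) 1 := by
  obtain ⟨hm, -, h0, h1⟩ := hF
  constructor
  · have := hm.le_of_tendsto h0 (x - 1)
    have := hFmono (show x - 1 < x by linarith)
    linarith
  · have := hm.ge_of_tendsto h1 (x + 1)
    have := hFmono (show x < x + 1 by linarith)
    linarith

lemma qf_cdf17 (F : ℝ → ℝ) (hFmono : StrictMono F) (x : ℝ) : qf F (F x) = x := by
  have : {y | F x ≤ F y} = Set.Ici x := by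
    ext y; simp [hFmono.le_iff_le]
  rw [qf, this, csInf_Ici]

lemma cdf_surj17 (F : ℝ → ℝ) (hF : IsCDF F) (hFcont : Continuous F) (p : ℝ)
    (hp : p ∈ Set.Ioo (0:ℝ) 1) : ∃ x, F x = p := by
  obtain ⟨hm, -, h0, h1⟩ := hF
  obtain ⟨a, ha⟩ := (h0.eventually_lt_const hp.1).exists
  obtain ⟨b, hb⟩ := (h1.eventually_const_lt hp.2).exists
  exact mem_range_of_exists_le_of_exists_ge hFcont ⟨a, ha.le⟩ ⟨b, hb.le⟩

lemma cdf_qf17 (F : ℝ → ℝ) (hF : IsCDF F) (hFcont : Continuous F) (hFmono : StrictMono F) (p : ℝ)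
    (hp : p ∈ Set.Ioo (0:ℝ) 1) : F (qf F p) = p := by
  obtain ⟨x, rfl⟩ := cdf_surj17 F hF hFcont p hp
  rw [qf_cdf17 F hFmono]

lemma betaLaw_prob17 (i n : ℕ) (hi1 : 1 ≤ i) (hin : i ≤ n) :
    IsProbabilityMeasure (betaLaw i n) := by
  have hi : (0:ℝ) ≤ (i:ℝ) - 1 := by
    have : (1:ℝ) ≤ i := by exact_mod_cast hi1
    linarith
  have hn : (0:ℝ) ≤ (n:ℝ) - i := by
    have : (i:ℝ) ≤ n := by exact_mod_cast hin
    linarith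
  set f : ℝ → ℝ := fun t => t ^ ((i:ℝ) - 1) * (1 - t) ^ ((n:ℝ) - (i:ℝ)) with hf
  have hc : Continuous f :=
    (Real.continuous_rpow_const hi).mul
      ((Real.continuous_rpow_const hn).comp (continuous_const.sub continuous_id))
  have hint : IntegrableOn f (Set.Ioo 0 1) :=
    (hc.integrableOn_Icc (a := 0) (b := 1)).mono_set Set.Ioo_subset_Icc_self
  have hpos : ∀ t ∈ Set.Ioo (0:ℝ) 1, 0 < f t := fun t ht =>
    mul_pos (Real.rpow_pos_of_pos ht.1 _) (Real.rpow_pos_of_pos (by linarith [ht.2]) _)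
  have hae : 0 ≤ᵐ[volume.restrict (Set.Ioo (0:ℝ) 1)] f :=
    (ae_restrict_iff' measurableSet_Ioo).2 (ae_of_all _ fun t ht => (hpos t ht).le)
  have hB : Bfun (i:ℝ) ((n:ℝ) - i + 1) = ∫ t in Set.Ioo (0:ℝ) 1, f t := by
    simp [Bfun, hf]
  have hBpos : 0 < ∫ t in Set.Ioo (0:ℝ) 1, f t := by
    rw [setIntegral_pos_iff_support_of_nonneg_ae hae hint]
    have : Function.support f ∩ Set.Ioo (0:ℝ) 1 = Set.Ioo 0 1 :=
      Set.inter_eq_right.2 fun t ht => (hpos t ht).ne'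
    rw [this]; simp
  constructor
  rw [betaLaw, withDensity_apply _ MeasurableSet.univ, Measure.restrict_univ, hB,
    ← ofReal_integral_eq_lintegral_ofReal (hint.div_const _), integral_div]
  · rw [div_self hBpos.ne', ENNReal.ofReal_one]
  · filter_upwards [hae] with t ht
    exact div_nonneg ht hBpos.le

lemma betaLaw_ae17 (i n : ℕ) : ∀ᵐ p ∂(betaLaw i n), p ∈ Set.Ioo (0:ℝ) 1 :=
  (withDensity_absolutelyContinuous _ _).ae_le (ae_restrict_mem measurableSet_Ioo)

/-- With `p_{i:n}^G = G(E[G⁻¹(B_{i:n})])` and `X ∼ F` (so that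
`P(X ≤ t) = F(t)` and `E X_{i:n} = E[F⁻¹(B_{i:n})]`): if `G⁻¹ ∘ F` is convex then
`P(X ≤ E X_{i:n}) ≤ p_{i:n}^G`; if `G⁻¹ ∘ F` is concave then `P(X ≤ E X_{i:n}) ≥ p_{i:n}^G`. -/
theorem stmt17 (G : ℝ → ℝ) (hG : IsCDF G) (hGcont : Continuous G) (hGmono : StrictMono G)
    (F : ℝ → ℝ) (hF : IsCDF F) (hFcont : Continuous F) (hFmono : StrictMono F)
    (i n : ℕ) (hi1 : 1 ≤ i) (hin : i ≤ n)
    (hFfin : MeasureTheory.Integrable (qf F) (betaLaw i n))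
    (hGfin : MeasureTheory.Integrable (qf G) (betaLaw i n)) :
    (ConvexOn ℝ Set.univ (fun x => qf G (F x)) →
      F (∫ p, qf F p ∂(betaLaw i n)) ≤ G (∫ p, qf G p ∂(betaLaw i n))) ∧
    (ConcaveOn ℝ Set.univ (fun x => qf G (F x)) →
      G (∫ p, qf G p ∂(betaLaw i n)) ≤ F (∫ p, qf F p ∂(betaLaw i n))) := by
  haveI := betaLaw_prob17 i n hi1 hin
  have hae : (fun p => qf G (F (qf F p))) =ᵐ[betaLaw i n] qf G := by
    filter_upwards [betaLaw_ae17 i n] with p hp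
    rw [cdf_qf17 F hF hFcont hFmono p hp]
  have hI : Integrable (fun p => qf G (F (qf F p))) (betaLaw i n) := hGfin.congr hae.symm
  have hFG : ∀ x, G (qf G (F x)) = F x := fun x =>
    cdf_qf17 G hG hGcont hGmono _ (cdf_mem17 F hF hFmono x)
  constructor
  · intro h
    have hj := h.map_integral_le (h.continuousOn isOpen_univ) isClosed_univ
      (ae_of_all _ fun _ => Set.mem_univ _) hFfin hI
    rw [integral_congr_ae hae] at hj
    rw [← hFG]
    exact hGmono.monotone hj
  · intro h
    have hj := h.le_map_integral (h.continuousOn isOpen_univ) isClosed_univ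
      (ae_of_all _ fun _ => Set.mem_univ _) hFfin hI
    rw [integral_congr_ae hae] at hj
    rw [← hFG (∫ p, qf F p ∂(betaLaw i n))]
    exact hGmono.monotone hj
end
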